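/- Lax representation of the H₀-flow of the elliptic sl(N) Gaudin model (Proposition 2.1, part 2): Let z_1,…,z_n ∈ ℂ satisfy z_a − z_c ∉ Γ_τ for all a ≠ c. Let S^c(t) = ∑_{γ∈Γ'_N} S^c_γ(t) T_γ for c = 1,…,n, with differentiable coefficients S^c_γ : ℝ → ℂ. Define L(t,z) = ∑_{c=1}^n ∑_{γ∈Γ'_N} S^c_γ(t) T_γ φ_γ(z − z_c) and M_0(t,z) = −∑_{b=1}^n ∑_{γ∈Γ'_N} S^b_γ(t) T_γ f_γ(z − z_b). Then the equations of motion d/dt S^a = [S^a, ℘̂(S^a)] − ∑_{c≠a} [S^a, f̂_{z_a−z_c}(S^c)] for every a = 1,…,n hold for all t if and only if the Lax equation ∂_t L(t,z) = [L(t,z), M_0(t,z)] holds for all t and all z ∈ ℂ with z − z_c ∉ Γ_τ for every c. -/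

import Mathlib

open scoped BigOperators
open Complex Matrix Finset

noncomputable section

/-- The lattice `Γ_τ = ℤ + τℤ`. -/
def latticeGamma (τ : ℂ) : Set ℂ := {w | ∃ m n : ℤ, w = (m : ℂ) + (n : ℂ) * τ}

/-- The odd theta function `ϑ(z|τ)`. -/
def theta (τ z : ℂ) : ℂ :=
  Complex.exp (2 * (Real.pi : ℂ) * Complex.I * τ / 8) *
    ∑' m : ℤ, (-1 : ℂ) ^ m *
      Complex.exp (2 * (Real.pi : ℂ) * Complex.I * ((m : ℂ) * ((m : ℂ) + 1) * τ / 2 + (m : ℂ) * z))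

/-- The first Eisenstein function `E₁(z) = ϑ'(z)/ϑ(z)`. -/
def E1 (τ z : ℂ) : ℂ := deriv (theta τ) z / theta τ z

/-- The second Eisenstein function `E₂(z) = −E₁'(z)`. -/
def E2 (τ z : ℂ) : ℂ := -deriv (E1 τ) z

/-- The constant `η₁` determined by `E₁(z) = 1/z − 2η₁z + O(z³)` near `z = 0`. -/
def eta1 (τ : ℂ) : ℂ :=
  -(deriv (fun z : ℂ => if z = 0 then 0 else E1 τ z - 1 / z) 0) / 2

/-- The Weierstrass function `℘(z) = E₂(z) − 2η₁`. -/
def wp (τ z : ℂ) : ℂ := E2 τ z - 2 * eta1 τ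

/-- The Kronecker function `φ(u,z) = ϑ(u+z)ϑ'(0)/(ϑ(u)ϑ(z))`. -/
def kronPhi (τ u z : ℂ) : ℂ := theta τ (u + z) * deriv (theta τ) 0 / (theta τ u * theta τ z)

/-- `f(u,z) = ∂_u φ(u,z)`. -/
def kronF (τ u z : ℂ) : ℂ := deriv (fun u' => kronPhi τ u' z) u

/-- `e_N(z) = exp(2πiz/N)`. -/
def eN (N : ℕ) (z : ℂ) : ℂ := Complex.exp (2 * (Real.pi : ℂ) * Complex.I * z / N)

/-- The matrix `Q = diag(e_N(1),…,e_N(N−1),1)`. -/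
def Qm (N : ℕ) : Matrix (Fin N) (Fin N) ℂ :=
  Matrix.diagonal fun i => eN N ((i : ℕ) + 1)

/-- The cyclic shift matrix `Λ`. -/
def Lm (N : ℕ) : Matrix (Fin N) (Fin N) ℂ :=
  Matrix.of fun i j => if ((i : ℕ) + 1) % N = (j : ℕ) then 1 else 0

/-- The basis matrices `T_γ = e_N(γ₁γ₂/2) Q^{γ₁} Λ^{γ₂}` for `γ ∈ ℤ²`. -/
def Tm (N : ℕ) (γ : ℤ × ℤ) : Matrix (Fin N) (Fin N) ℂ :=
  eN N (((γ.1 * γ.2 : ℤ) : ℂ) / 2) • (Qm N ^ γ.1 * Lm N ^ γ.2)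

/-- `ω_γ = (γ₁ + γ₂τ)/N`. -/
def om (N : ℕ) (τ : ℂ) (γ : ℤ × ℤ) : ℂ := ((γ.1 : ℂ) + (γ.2 : ℂ) * τ) / N

/-- `φ_γ(z) = e_N(γ₂z) φ(ω_γ, z)`. -/
def phiG (N : ℕ) (τ : ℂ) (γ : ℤ × ℤ) (z : ℂ) : ℂ := eN N ((γ.2 : ℂ) * z) * kronPhi τ (om N τ γ) z

/-- `f_γ(z) = e_N(γ₂z) f(ω_γ, z)`. -/
def fG (N : ℕ) (τ : ℂ) (γ : ℤ × ℤ) (z : ℂ) : ℂ := eN N ((γ.2 : ℂ) * z) * kronF τ (om N τ γ) z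

/-- `F_γ(z) = φ_γ(z)E₁(z) − f_γ(z)`. -/
def FG (N : ℕ) (τ : ℂ) (γ : ℤ × ℤ) (z : ℂ) : ℂ := phiG N τ γ z * E1 τ z - fG N τ γ z

/-- A fixed set of representatives of the nonzero classes of `(ℤ/Nℤ)²`. -/
def GammaN' (N : ℕ) : Finset (ℤ × ℤ) :=
  ((Finset.range N ×ˢ Finset.range N).image fun p => ((p.1 : ℤ), (p.2 : ℤ))) \ {(0, 0)}


/-- The matrix `S^c(t) = ∑_{γ∈Γ'_N} S^c_γ(t) T_γ`. -/
def Smat (N : ℕ) {n : ℕ} (S : Fin n → (ℤ × ℤ) → ℝ → ℂ) (c : Fin n) (t : ℝ) :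
    Matrix (Fin N) (Fin N) ℂ :=
  ∑ γ ∈ GammaN' N, S c γ t • Tm N γ

/-- `f̂_w(S^c(t)) = ∑_{γ∈Γ'_N} S^c_γ(t) f_γ(w) T_γ`. -/
def fHatS (N : ℕ) (τ : ℂ) {n : ℕ} (S : Fin n → (ℤ × ℤ) → ℝ → ℂ) (w : ℂ) (c : Fin n)
    (t : ℝ) : Matrix (Fin N) (Fin N) ℂ :=
  ∑ γ ∈ GammaN' N, (S c γ t * fG N τ γ w) • Tm N γ

/-- `℘̂(S^c(t)) = ∑_{γ∈Γ'_N} S^c_γ(t) ℘(ω_γ) T_γ`. -/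
def wpHatS (N : ℕ) (τ : ℂ) {n : ℕ} (S : Fin n → (ℤ × ℤ) → ℝ → ℂ) (c : Fin n)
    (t : ℝ) : Matrix (Fin N) (Fin N) ℂ :=
  ∑ γ ∈ GammaN' N, (S c γ t * wp τ (om N τ γ)) • Tm N γ


lemma J_prod (τ : ℂ) (hτ : 0 < τ.im) (x y : ℂ) :
    jacobiTheta₂ (x + y) τ * jacobiTheta₂ (x - y) τ =
      jacobiTheta₂ (2 * x) (2 * τ) * jacobiTheta₂ (2 * y) (2 * τ) +
      cexp (Real.pi * I * τ + 2 * Real.pi * I * (x + y)) *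
        (jacobiTheta₂ (2 * x + τ) (2 * τ) * jacobiTheta₂ (2 * y + τ) (2 * τ)) := by
  have h2τ : 0 < (2 * τ).im := by simpa using hτ
  have s1 : ∀ z, Summable (fun n => ‖jacobiTheta₂_term n z τ‖) := fun z =>
    ((summable_jacobiTheta₂_term_iff z τ).2 hτ).norm
  have s2 : ∀ z, Summable (fun n => ‖jacobiTheta₂_term n z (2 * τ)‖) := fun z =>
    ((summable_jacobiTheta₂_term_iff z (2 * τ)).2 h2τ).norm
  simp only [jacobiTheta₂]
  rw [tsum_mul_tsum_of_summable_norm (s1 _) (s1 _), tsum_mul_tsum_of_summable_norm (s2 _) (s2 _),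
    tsum_mul_tsum_of_summable_norm (s2 _) (s2 _), ← tsum_mul_left]
  let e : (ℤ × ℤ) ⊕ (ℤ × ℤ) ≃ ℤ × ℤ :=
    { toFun := Sum.elim (fun p => (p.1 + p.2, p.1 - p.2)) (fun p => (p.1 + p.2 + 1, p.1 - p.2))
      invFun := fun p => if (p.1 + p.2) % 2 = 0 then Sum.inl ((p.1 + p.2) / 2, (p.1 - p.2) / 2)
        else Sum.inr ((p.1 + p.2) / 2, (p.1 - p.2) / 2)
      left_inv := by
        rintro (⟨a, b⟩ | ⟨a, b⟩)
        · have : (a + b + (a - b)) % 2 = 0 := by omega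
          simp only [Sum.elim_inl, this, if_true]
          congr 2 <;> omega
        · have : ¬ (a + b + 1 + (a - b)) % 2 = 0 := by omega
          simp only [Sum.elim_inr, this, if_false]
          congr 2 <;> omega
      right_inv := by
        rintro ⟨a, b⟩
        by_cases h : (a + b) % 2 = 0
        · simp only [h, if_true, Sum.elim_inl]
          ext <;> simp <;> omega
        · simp only [h, if_false, Sum.elim_inr]
          ext <;> simp <;> omega }
  have hs := (summable_mul_of_summable_norm (s1 (x + y)) (s1 (x - y)))
  rw [← e.tsum_eq]
  rw [← e.summable_iff] at hs
  have hi : ∀ p : ℤ × ℤ, jacobiTheta₂_term (e (Sum.inl p)).1 (x + y) τ *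
      jacobiTheta₂_term (e (Sum.inl p)).2 (x - y) τ =
      jacobiTheta₂_term p.1 (2 * x) (2 * τ) * jacobiTheta₂_term p.2 (2 * y) (2 * τ) := by
    rintro ⟨a, b⟩
    simp only [e, Equiv.coe_fn_mk, Sum.elim_inl, jacobiTheta₂_term, ← Complex.exp_add]
    congr 1; push_cast; ring
  have hr : ∀ p : ℤ × ℤ, jacobiTheta₂_term (e (Sum.inr p)).1 (x + y) τ *
      jacobiTheta₂_term (e (Sum.inr p)).2 (x - y) τ =
      cexp (Real.pi * I * τ + 2 * Real.pi * I * (x + y)) *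
      (jacobiTheta₂_term p.1 (2 * x + τ) (2 * τ) * jacobiTheta₂_term p.2 (2 * y + τ) (2 * τ)) := by
    rintro ⟨a, b⟩
    simp only [e, Equiv.coe_fn_mk, Sum.elim_inr, jacobiTheta₂_term, ← Complex.exp_add]
    congr 1; push_cast; ring
  rw [Summable.tsum_sum]
  · simp only [hi, hr]
  · exact hs.comp_injective Sum.inl_injective
  · exact hs.comp_injective Sum.inr_injective

lemma J_ne (τ : ℂ) (hτ : 0 < τ.im) : ∃ z, jacobiTheta₂ z τ ≠ 0 := by
  by_contra! hcon
  have hc : ∀ n : ℤ, Continuous (fun x : ℝ => jacobiTheta₂_term n (x : ℂ) τ) := by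
    intro n; unfold jacobiTheta₂_term; fun_prop
  have hb : ∀ (n : ℤ) (x : ℝ), ‖jacobiTheta₂_term n (x : ℂ) τ‖ = ‖jacobiTheta₂_term n 0 τ‖ := by
    intro n x; simp [norm_jacobiTheta₂_term]
  have hs : Summable (fun n => ‖jacobiTheta₂_term n 0 τ‖) :=
    ((summable_jacobiTheta₂_term_iff 0 τ).2 hτ).norm
  have key := intervalIntegral.hasSum_integral_of_dominated_convergence (μ := MeasureTheory.volume)
    (a := 0) (b := 1) (F := fun (n : ℤ) (x : ℝ) => jacobiTheta₂_term n (x : ℂ) τ)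
    (f := fun x => jacobiTheta₂ (x : ℂ) τ)
    (fun n _ => ‖jacobiTheta₂_term n 0 τ‖)
    (fun n => (hc n).aestronglyMeasurable)
    (fun n => Filter.Eventually.of_forall fun x _ => (hb n x).le)
    (Filter.Eventually.of_forall fun x _ => hs)
    (by simp)
    (Filter.Eventually.of_forall fun x _ => hasSum_jacobiTheta₂_term _ hτ)
  have h0 : ∀ n : ℤ, (∫ x in (0:ℝ)..1, jacobiTheta₂_term n (x : ℂ) τ) = if n = 0 then 1 else 0 := by
    intro n
    by_cases hn : n = 0
    · simp [hn, jacobiTheta₂_term]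
    · rw [if_neg hn]
      have hne : (2 * Real.pi * I * n : ℂ) ≠ 0 := by
        simp [Real.pi_ne_zero, hn, I_ne_zero]
      have : ∀ x : ℝ, jacobiTheta₂_term n (x : ℂ) τ =
          cexp (Real.pi * I * n ^ 2 * τ) * cexp ((2 * Real.pi * I * n) * x) := by
        intro x; rw [jacobiTheta₂_term, ← Complex.exp_add]; congr 1; ring
      simp only [this]
      rw [intervalIntegral.integral_const_mul, integral_exp_mul_complex hne]
      have : cexp (2 * Real.pi * I * n) = 1 := by
        rw [mul_comm, exp_int_mul_two_pi_mul_I]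
      simp [this]
  simp only [h0, hcon, intervalIntegral.integral_zero] at key
  have := (hasSum_ite_eq (0 : ℤ) (1 : ℂ)).unique key
  exact one_ne_zero this


/-- The genuinely odd theta function. -/
def sg (τ z : ℂ) : ℂ := cexp (Real.pi * I * z) * theta τ z

lemma neg_cexp (a : ℂ) : -cexp a = cexp (Real.pi * I + a) := by
  rw [Complex.exp_add, Complex.exp_pi_mul_I]; ring

lemma theta_eq_J (τ z : ℂ) : theta τ z =
    cexp (2 * (Real.pi : ℂ) * I * τ / 8) * jacobiTheta₂ (z + τ / 2 + 1 / 2) τ := by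
  unfold theta jacobiTheta₂
  congr 1
  refine tsum_congr fun m => ?_
  have h1 : (-1 : ℂ) ^ m = cexp (m * (Real.pi * I)) := by
    rw [Complex.exp_int_mul, Complex.exp_pi_mul_I]
  rw [h1, jacobiTheta₂_term, ← Complex.exp_add]
  congr 1; ring

lemma theta_eq_sg (τ z : ℂ) : theta τ z = cexp (-(Real.pi * I * z)) * sg τ z := by
  rw [sg, ← mul_assoc, ← Complex.exp_add]; simp

lemma sg_eq_J (τ z : ℂ) : sg τ z = cexp (Real.pi * I * z + 2 * (Real.pi : ℂ) * I * τ / 8) *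
    jacobiTheta₂ (z + τ / 2 + 1 / 2) τ := by
  rw [sg, theta_eq_J, ← mul_assoc, ← Complex.exp_add]

lemma sg_differentiable (τ : ℂ) (hτ : 0 < τ.im) : Differentiable ℂ (sg τ) := by
  have : sg τ = fun z => cexp (Real.pi * I * z + 2 * (Real.pi : ℂ) * I * τ / 8) *
    jacobiTheta₂ (z + τ / 2 + 1 / 2) τ := funext (sg_eq_J τ)
  rw [this]
  intro z
  refine DifferentiableAt.mul (by fun_prop) ?_
  exact (differentiableAt_jacobiTheta₂_fst (z + τ / 2 + 1 / 2) hτ).comp z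
    (f := fun z => z + τ / 2 + 1 / 2) (by fun_prop)

lemma sg_ne (τ : ℂ) (hτ : 0 < τ.im) : ∃ z, sg τ z ≠ 0 := by
  obtain ⟨z, hz⟩ := J_ne τ hτ
  refine ⟨z - τ / 2 - 1 / 2, ?_⟩
  rw [sg_eq_J]
  refine mul_ne_zero (Complex.exp_ne_zero _) ?_
  convert hz using 2; ring

lemma sg_add_one (τ z : ℂ) : sg τ (z + 1) = - sg τ z := by
  rw [sg_eq_J, sg_eq_J, show z + 1 + τ / 2 + 1 / 2 = z + τ / 2 + 1 / 2 + 1 by ring,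
    jacobiTheta₂_add_left, ← neg_mul]
  congr 1
  rw [show (Real.pi * I * (z + 1) + 2 * (Real.pi : ℂ) * I * τ / 8) =
    (Real.pi * I * z + 2 * (Real.pi : ℂ) * I * τ / 8) + Real.pi * I by ring, Complex.exp_add,
    Complex.exp_pi_mul_I]
  ring

lemma sg_add_tau (τ z : ℂ) : sg τ (z + τ) =
    - cexp (-(Real.pi * I * τ) - 2 * Real.pi * I * z) * sg τ z := by
  rw [sg_eq_J, sg_eq_J, show z + τ + τ / 2 + 1 / 2 = z + τ / 2 + 1 / 2 + τ by ring,
    jacobiTheta₂_add_left', ← mul_assoc, ← mul_assoc]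
  congr 1
  rw [neg_cexp, ← Complex.exp_add, ← Complex.exp_add, Complex.exp_eq_exp_iff_exists_int]
  exact ⟨-1, by push_cast; ring⟩

lemma sg_prod (τ : ℂ) (hτ : 0 < τ.im) : ∃ A B : ℂ → ℂ, ∀ x y,
    sg τ (x + y) * sg τ (x - y) = A x * B y - B x * A y := by
  refine ⟨fun x => cexp (2 * Real.pi * I * τ / 4) *
    (cexp (2 * Real.pi * I * x) * jacobiTheta₂ (2 * x + τ) (2 * τ)),
    fun x => jacobiTheta₂ (2 * x) (2 * τ), fun x y => ?_⟩
  have h1 := J_prod τ hτ (x + τ / 2 + 1 / 2) y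
  rw [show 2 * (x + τ / 2 + 1 / 2) = 2 * x + τ + 1 by ring, jacobiTheta₂_add_left,
    show 2 * x + τ + 1 + τ = 2 * x + 1 + 2 * τ by ring, jacobiTheta₂_add_left',
    jacobiTheta₂_add_left] at h1
  rw [sg_eq_J, sg_eq_J, show x + y + τ / 2 + 1 / 2 = (x + τ / 2 + 1 / 2) + y by ring,
    show x - y + τ / 2 + 1 / 2 = (x + τ / 2 + 1 / 2) - y by ring]
  have h2 : cexp (Real.pi * I * (x + y) + 2 * (Real.pi : ℂ) * I * τ / 8) *
      cexp (Real.pi * I * (x - y) + 2 * (Real.pi : ℂ) * I * τ / 8) =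
      cexp (2 * Real.pi * I * τ / 4) * cexp (2 * Real.pi * I * x) := by
    rw [← Complex.exp_add, ← Complex.exp_add]; congr 1; ring
  have h3 : cexp (2 * Real.pi * I * x) *
      (cexp (Real.pi * I * τ + 2 * Real.pi * I * (x + τ / 2 + 1 / 2 + y)) *
      cexp (-Real.pi * I * (2 * τ + 2 * (2 * x + 1)))) = - cexp (2 * Real.pi * I * y) := by
    rw [neg_cexp, ← Complex.exp_add, ← Complex.exp_add, Complex.exp_eq_exp_iff_exists_int]
    exact ⟨-1, by push_cast; ring⟩
  calc _ = (cexp (Real.pi * I * (x + y) + 2 * (Real.pi : ℂ) * I * τ / 8) *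
      cexp (Real.pi * I * (x - y) + 2 * (Real.pi : ℂ) * I * τ / 8)) *
      (jacobiTheta₂ (x + τ / 2 + 1 / 2 + y) τ * jacobiTheta₂ (x + τ / 2 + 1 / 2 - y) τ) := by ring
    _ = _ := by
      rw [h2, h1]
      linear_combination (cexp (2 * Real.pi * I * τ / 4) * jacobiTheta₂ (2 * x) (2 * τ) *
        jacobiTheta₂ (2 * y + τ) (2 * τ)) * h3

lemma sg_neg (τ : ℂ) (hτ : 0 < τ.im) (z : ℂ) : sg τ (-z) = - sg τ z := by
  obtain ⟨A, B, h⟩ := sg_prod τ hτ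
  obtain ⟨s, hs⟩ := sg_ne τ hτ
  have h1 := h ((s + z) / 2) ((s - z) / 2)
  have h2 := h ((s - z) / 2) ((s + z) / 2)
  ring_nf at h1 h2
  have : sg τ s * (sg τ (-z) + sg τ z) = 0 := by linear_combination h1 + h2
  rcases mul_eq_zero.1 this with h | h
  · exact absurd h hs
  · exact eq_neg_of_add_eq_zero_left h

lemma sg_zero (τ : ℂ) (hτ : 0 < τ.im) : sg τ 0 = 0 := by
  have := sg_neg τ hτ 0
  rw [neg_zero] at this
  exact self_eq_neg.1 this

lemma sg_W (τ : ℂ) (hτ : 0 < τ.im) (u v x y : ℂ) :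
    sg τ (u + x) * sg τ (v + y) * sg τ (u + v) * sg τ (y - x) =
    sg τ (u + v + x) * sg τ (v + y - x) * sg τ u * sg τ y -
    sg τ (u + v + y) * sg τ (u + x - y) * sg τ v * sg τ x := by
  obtain ⟨A, B, h⟩ := sg_prod τ hτ
  have key : ∀ z a b c, sg τ (z + a) * sg τ (z - a) * (sg τ (b + c) * sg τ (b - c)) +
      sg τ (z + b) * sg τ (z - b) * (sg τ (c + a) * sg τ (c - a)) +
      sg τ (z + c) * sg τ (z - c) * (sg τ (a + b) * sg τ (a - b)) = 0 := by
    intro z a b c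
    rw [h, h, h, h, h, h]; ring
  have k := key ((u + x + v + y) / 2) ((u + x - v - y) / 2) ((u + v + y - x) / 2)
    ((u + v - y + x) / 2)
  rw [show (u + x + v + y) / 2 + (u + x - v - y) / 2 = u + x by ring,
    show (u + x + v + y) / 2 - (u + x - v - y) / 2 = v + y by ring,
    show (u + v + y - x) / 2 + (u + v - y + x) / 2 = u + v by ring,
    show (u + v + y - x) / 2 - (u + v - y + x) / 2 = y - x by ring,
    show (u + x + v + y) / 2 + (u + v + y - x) / 2 = u + v + y by ring,
    show (u + x + v + y) / 2 - (u + v + y - x) / 2 = x by ring,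
    show (u + v - y + x) / 2 + (u + x - v - y) / 2 = u + x - y by ring,
    show (u + v - y + x) / 2 - (u + x - v - y) / 2 = v by ring,
    show (u + x + v + y) / 2 + (u + v - y + x) / 2 = u + v + x by ring,
    show (u + x + v + y) / 2 - (u + v - y + x) / 2 = y by ring,
    show (u + x - v - y) / 2 + (u + v + y - x) / 2 = u by ring,
    show (u + x - v - y) / 2 - (u + v + y - x) / 2 = -(v + y - x) by ring, sg_neg τ hτ] at k
  linear_combination k

lemma sg_hasDerivAt (τ : ℂ) (hτ : 0 < τ.im) (z : ℂ) : HasDerivAt (sg τ) (deriv (sg τ) z) z :=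
  (sg_differentiable τ hτ z).hasDerivAt

/-- Derivative of the identity `sg_W` in `y` at `y = x`. -/
lemma sg_W' (τ : ℂ) (hτ : 0 < τ.im) (u v x : ℂ) :
    sg τ (u + x) * sg τ (v + x) * sg τ (u + v) * deriv (sg τ) 0 =
    sg τ (u + v + x) * (deriv (sg τ) v * sg τ u * sg τ x + sg τ v * sg τ u * deriv (sg τ) x
      + deriv (sg τ) u * sg τ v * sg τ x) - deriv (sg τ) (u + v + x) * sg τ u * sg τ v * sg τ x := by
  have d := fun z => sg_hasDerivAt τ hτ z
  have hid := hasDerivAt_id x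
  have a1 : HasDerivAt (fun y => sg τ (v + y)) (deriv (sg τ) (v + x)) x := by
    simpa using (d (v + x)).comp_const_add v x
  have a2 : HasDerivAt (fun y => sg τ (y - x)) (deriv (sg τ) 0) x := by
    have := (d (x - x)).comp_sub_const x x
    simpa using this
  have a3 : HasDerivAt (fun y => sg τ (v + y - x)) (deriv (sg τ) v) x := by
    have : HasDerivAt (fun y => sg τ ((v - x) + y)) (deriv (sg τ) ((v - x) + x)) x :=
      (d ((v - x) + x)).comp_const_add (v - x) x
    rw [sub_add_cancel] at this
    convert this using 3; ring
  have a4 : HasDerivAt (fun y => sg τ (u + v + y)) (deriv (sg τ) (u + v + x)) x := by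
    simpa using (d (u + v + x)).comp_const_add (u + v) x
  have a5 : HasDerivAt (fun y => sg τ (u + x - y)) (-deriv (sg τ) u) x := by
    have := (d (u + x - x)).comp_const_sub (u + x) x
    rwa [add_sub_cancel_right] at this
  have l1 := ((a1.const_mul (sg τ (u + x))).mul_const (sg τ (u + v))).mul a2
  have l2 := (((a3.const_mul (sg τ (u + v + x))).mul_const (sg τ u)).mul (d x)).sub
    (((a4.mul a5).mul_const (sg τ v)).mul_const (sg τ x))
  have e : (fun y => sg τ (u + x) * sg τ (v + y) * sg τ (u + v) * sg τ (y - x)) =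
    (fun y => sg τ (u + v + x) * sg τ (v + y - x) * sg τ u * sg τ y -
    sg τ (u + v + y) * sg τ (u + x - y) * sg τ v * sg τ x) := funext fun y => sg_W τ hτ u v x y
  have l2' : HasDerivAt (fun y => sg τ (u + v + x) * sg τ (v + y - x) * sg τ u * sg τ y -
    sg τ (u + v + y) * sg τ (u + x - y) * sg τ v * sg τ x) _ x := l2
  rw [← e] at l2'
  have := HasDerivAt.unique l1 l2'
  simp only [sub_self, sg_zero τ hτ, add_sub_cancel_right] at this
  linear_combination this


lemma sg_analytic (τ : ℂ) (hτ : 0 < τ.im) : AnalyticOnNhd ℂ (sg τ) Set.univ :=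
  fun z _ => (sg_differentiable τ hτ).analyticAt z

lemma sg_mul_ne (τ : ℂ) (hτ : 0 < τ.im) (z : ℂ) : ∃ v, sg τ (z - v) ≠ 0 ∧ sg τ v ≠ 0 := by
  by_contra! hcon
  obtain ⟨p, hp⟩ := sg_ne τ hτ
  have hev : ∀ᶠ x in nhds p, sg τ x ≠ 0 := (sg_differentiable τ hτ).continuous.continuousAt.eventually_ne hp
  have hd : Differentiable ℂ (fun v => sg τ (z - v)) :=
    (sg_differentiable τ hτ).comp (differentiable_id.const_sub z)
  have := AnalyticOnNhd.eq_of_eventuallyEq (f := fun v => sg τ (z - v)) (g := fun _ => (0 : ℂ))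
    (z₀ := p) (fun w _ => hd.analyticAt w) (fun w _ => analyticAt_const)
    (by filter_upwards [hev] with x hx
        by_contra h
        exact hx (hcon x h))
  have := congrFun this (z - p)
  simp at this
  exact hp this

lemma sg_prop (τ : ℂ) (hτ : 0 < τ.im) (z0 κ : ℂ)
    (h : ∀ x, deriv (sg τ) (z0 + x) * sg τ x - sg τ (z0 + x) * deriv (sg τ) x =
      κ * sg τ (z0 + x) * sg τ x) : ∃ C : ℂ, ∀ x, sg τ (z0 + x) * cexp (-κ * x) = C * sg τ x := by
  obtain ⟨p, hp⟩ := sg_ne τ hτ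
  have hev : ∀ᶠ x in nhds p, sg τ x ≠ 0 :=
    (sg_differentiable τ hτ).continuous.continuousAt.eventually_ne hp
  obtain ⟨ε, hε, hball⟩ := Metric.eventually_nhds_iff_ball.1 hev
  have hg : ∀ x, HasDerivAt (fun x => sg τ (z0 + x) * cexp (-κ * x))
      (deriv (sg τ) (z0 + x) * cexp (-κ * x) + sg τ (z0 + x) * (cexp (-κ * x) * (-κ))) x := by
    intro x
    have a1 : HasDerivAt (fun y => sg τ (z0 + y)) (deriv (sg τ) (z0 + x)) x :=
      (sg_hasDerivAt τ hτ (z0 + x)).comp_const_add z0 x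
    have a2 : HasDerivAt (fun x => cexp (-κ * x)) (cexp (-κ * x) * (-κ)) x := by
      have := ((hasDerivAt_id x).const_mul (-κ)).cexp
      simpa using this
    exact a1.mul a2
  have hq : ∀ x ∈ Metric.ball p ε, HasDerivAt (fun x => sg τ (z0 + x) * cexp (-κ * x) / sg τ x)
      0 x := by
    intro x hx
    refine ((hg x).fun_div (sg_hasDerivAt τ hτ x) (hball x hx)).congr_deriv ?_
    rw [div_eq_zero_iff]; left
    linear_combination cexp (-κ * x) * h x
  obtain ⟨C, hC⟩ := Metric.isOpen_ball.exists_is_const_of_deriv_eq_zero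
    ((convex_ball p ε).isPreconnected)
    (fun x hx => (hq x hx).differentiableAt.differentiableWithinAt)
    (fun x hx => (hq x hx).deriv)
  refine ⟨C, ?_⟩
  have hd1 : Differentiable ℂ (fun x => sg τ (z0 + x) * cexp (-κ * x)) :=
    fun x => (hg x).differentiableAt
  have hd2 : Differentiable ℂ (fun x => C * sg τ x) := (sg_differentiable τ hτ).const_mul C
  have := AnalyticOnNhd.eq_of_eventuallyEq (z₀ := p) (fun w _ => hd1.analyticAt w)
    (fun w _ => hd2.analyticAt w)
    (by filter_upwards [Metric.ball_mem_nhds p hε] with x hx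
        have := hC x hx
        rw [div_eq_iff (hball x hx)] at this
        exact this)
  exact fun x => congrFun this x

lemma sg_mem_lattice (τ : ℂ) (hτ : 0 < τ.im) (z0 κ : ℂ)
    (h : ∀ x, deriv (sg τ) (z0 + x) * sg τ x - sg τ (z0 + x) * deriv (sg τ) x =
      κ * sg τ (z0 + x) * sg τ x) : z0 ∈ latticeGamma τ := by
  obtain ⟨C, hC⟩ := sg_prop τ hτ z0 κ h
  obtain ⟨p, hp⟩ := sg_ne τ hτ
  set x := p - z0 with hx
  have h0 := hC x
  have h1 := hC (x + 1)
  have h2 := hC (x + τ)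
  rw [← add_assoc, sg_add_one, sg_add_one, mul_add, Complex.exp_add, mul_one] at h1
  rw [← add_assoc, sg_add_tau, sg_add_tau, mul_add (-κ), Complex.exp_add] at h2
  have hzx : z0 + x = p := by rw [hx]; ring
  rw [hzx] at h0 h1 h2
  have hne : sg τ p * cexp (-κ * x) ≠ 0 := mul_ne_zero hp (Complex.exp_ne_zero _)
  have e1 : cexp (-κ) = 1 := by
    apply mul_left_cancel₀ hne
    linear_combination -h1 - h0
  have e2 : cexp (-(Real.pi * I * τ) - 2 * Real.pi * I * p) * cexp (-κ * τ) =
      cexp (-(Real.pi * I * τ) - 2 * Real.pi * I * x) := by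
    apply mul_left_cancel₀ hne
    linear_combination -h2 + cexp (-(Real.pi * I * τ) - 2 * Real.pi * I * x) * (-h0)
  rw [← Complex.exp_add, Complex.exp_eq_exp_iff_exists_int] at e2
  obtain ⟨m, hm⟩ := e2
  obtain ⟨k, hk⟩ := Complex.exp_eq_one_iff.1 e1
  refine ⟨-m, k, ?_⟩
  have hpi : (2 * Real.pi * I : ℂ) ≠ 0 := by simp [Real.pi_ne_zero, I_ne_zero]
  apply mul_left_cancel₀ hpi
  push_cast
  linear_combination -hm + τ * hk + 2 * Real.pi * I * hzx

lemma sg_zero_or (τ : ℂ) (hτ : 0 < τ.im) (z0 : ℂ) (h : sg τ z0 * deriv (sg τ) 0 = 0) :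
    z0 ∈ latticeGamma τ := by
  obtain ⟨v, hu, hv⟩ := sg_mul_ne τ hτ z0
  refine sg_mem_lattice τ hτ z0
    ((deriv (sg τ) v * sg τ (z0 - v) + deriv (sg τ) (z0 - v) * sg τ v) / (sg τ (z0 - v) * sg τ v)) ?_
  intro x
  have := sg_W' τ hτ (z0 - v) v x
  rw [sub_add_cancel] at this
  field_simp
  linear_combination this - sg τ (z0 - v + x) * sg τ (v + x) * h

lemma sg_ne_zero (τ : ℂ) (hτ : 0 < τ.im) {z : ℂ} (h : z ∉ latticeGamma τ) : sg τ z ≠ 0 :=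
  fun h0 => h (sg_zero_or τ hτ z (by rw [h0, zero_mul]))

lemma lattice_coord {τ : ℂ} (hτ : 0 < τ.im) {a b : ℝ} {m k : ℤ}
    (h : (a : ℂ) + b * τ = m + k * τ) : a = m ∧ b = k := by
  have him := congrArg Complex.im h
  have hre := congrArg Complex.re h
  simp at him hre
  have hb : b = k := by
    rcases him with h | h
    · exact h
    · exact absurd h hτ.ne'
  subst hb
  exact ⟨by linarith, rfl⟩

lemma sg_deriv_zero_ne (τ : ℂ) (hτ : 0 < τ.im) : deriv (sg τ) 0 ≠ 0 := by
  intro h0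
  obtain ⟨m, k, h⟩ := sg_zero_or τ hτ (1 / 2) (by rw [h0, mul_zero])
  have h2 : (((1 / 2 : ℝ)) : ℂ) + ((0 : ℝ) : ℂ) * τ = m + k * τ := by
    push_cast; rw [← h]; ring
  have h1 := (lattice_coord hτ h2).1
  have : ((2 * m : ℤ) : ℝ) = ((1 : ℤ) : ℝ) := by push_cast; linarith
  have := Int.cast_injective this
  omega

lemma sg_lattice_zero (τ : ℂ) (hτ : 0 < τ.im) {z : ℂ} (h : z ∈ latticeGamma τ) : sg τ z = 0 := by
  obtain ⟨m, k, rfl⟩ := h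
  have h1 : sg τ (m : ℂ) = 0 := by
    induction m using Int.induction_on with
    | zero => simpa using sg_zero τ hτ
    | succ i ih => push_cast at ih ⊢; rw [sg_add_one, ih, neg_zero]
    | pred i ih =>
      push_cast at ih ⊢
      have := sg_add_one τ (-(i : ℂ) - 1)
      rw [sub_add_cancel, ih] at this
      simpa using this.symm
  induction k using Int.induction_on with
  | zero => simpa using h1
  | succ i ih =>
    push_cast at ih ⊢
    rw [add_mul, one_mul, ← add_assoc, sg_add_tau, ih, mul_zero]
  | pred i ih =>
    push_cast at ih ⊢
    have := sg_add_tau τ ((m : ℂ) + (-(i : ℂ) - 1) * τ)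
    rw [show (m : ℂ) + (-(i : ℂ) - 1) * τ + τ = m + -i * τ by ring, ih] at this
    have := mul_eq_zero.1 this.symm
    simpa [Complex.exp_ne_zero] using this


lemma theta_hasDerivAt (τ : ℂ) (hτ : 0 < τ.im) (z : ℂ) : HasDerivAt (theta τ)
    (cexp (-(Real.pi * I * z)) * (deriv (sg τ) z - Real.pi * I * sg τ z)) z := by
  have e : theta τ = fun z => cexp (-(Real.pi * I * z)) * sg τ z := funext (theta_eq_sg τ)
  rw [e]
  have a : HasDerivAt (fun z => cexp (-(Real.pi * I * z)))
      (cexp (-(Real.pi * I * z)) * (-(Real.pi * I))) z := by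
    have := (((hasDerivAt_id z).const_mul (Real.pi * I : ℂ)).neg).cexp
    simpa using this
  refine (a.mul (sg_hasDerivAt τ hτ z)).congr_deriv ?_
  ring

lemma kronPhi_eq (τ : ℂ) (hτ : 0 < τ.im) (u z : ℂ) :
    kronPhi τ u z = sg τ (u + z) * deriv (sg τ) 0 / (sg τ u * sg τ z) := by
  rw [kronPhi, (theta_hasDerivAt τ hτ 0).deriv, sg_zero τ hτ, theta_eq_sg, theta_eq_sg, theta_eq_sg]
  have : cexp (-(Real.pi * I * (u + z))) = cexp (-(Real.pi * I * u)) * cexp (-(Real.pi * I * z)) := by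
    rw [← Complex.exp_add]; congr 1; ring
  rw [this]
  have h1 := Complex.exp_ne_zero (-(Real.pi * I * u))
  have h2 := Complex.exp_ne_zero (-(Real.pi * I * z))
  rw [show cexp (-(Real.pi * I * u)) * sg τ u * (cexp (-(Real.pi * I * z)) * sg τ z) =
    (cexp (-(Real.pi * I * u)) * cexp (-(Real.pi * I * z))) * (sg τ u * sg τ z) by ring]
  rw [← mul_div_mul_left _ (sg τ u * sg τ z) (mul_ne_zero h1 h2)]
  congr 1
  simp; ring

lemma kronF_hasDerivAt (τ : ℂ) (hτ : 0 < τ.im) (u z : ℂ) (hu : sg τ u ≠ 0) (hz : sg τ z ≠ 0) :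
    HasDerivAt (fun u' => kronPhi τ u' z) (kronF τ u z) u := by
  rw [kronF]
  apply DifferentiableAt.hasDerivAt
  simp only [kronPhi_eq τ hτ]
  have d := sg_differentiable τ hτ
  have d1 : DifferentiableAt ℂ (fun u' => sg τ (u' + z)) u :=
    (d (u + z)).comp u (f := fun u' => u' + z) (by fun_prop)
  exact (d1.mul_const _).fun_div ((d u).mul_const _) (mul_ne_zero hu hz)

lemma fay (τ : ℂ) (hτ : 0 < τ.im) (u v x y : ℂ) (hu : sg τ u ≠ 0) (hv : sg τ v ≠ 0)
    (hx : sg τ x ≠ 0) (hy : sg τ y ≠ 0) (huv : sg τ (u + v) ≠ 0) (hyx : sg τ (y - x) ≠ 0) :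
    kronPhi τ u x * kronPhi τ v y =
      kronPhi τ (u + v) x * kronPhi τ v (y - x) + kronPhi τ (u + v) y * kronPhi τ u (x - y) := by
  have e : sg τ (x - y) = - sg τ (y - x) := by rw [← sg_neg τ hτ]; congr 1; ring
  simp only [kronPhi_eq τ hτ, e]
  have W := sg_W τ hτ u v x y
  rw [show v + (y - x) = v + y - x by ring, show u + (x - y) = u + x - y by ring]
  field_simp
  linear_combination deriv (sg τ) 0 ^ 2 * W

lemma shift_plus (τ : ℂ) (hτ : 0 < τ.im) (v y : ℂ) (hv : sg τ v ≠ 0) (hy : sg τ y ≠ 0) :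
    HasDerivAt (fun s => kronPhi τ (v + s) y) (kronF τ v y) 0 := by
  have := (kronF_hasDerivAt τ hτ v y hv hy)
  rw [← add_zero v] at this
  have := this.comp_const_add v 0
  simpa using this

lemma shift_minus (τ : ℂ) (hτ : 0 < τ.im) (v y : ℂ) (hv : sg τ v ≠ 0) (hy : sg τ y ≠ 0) :
    HasDerivAt (fun s => kronPhi τ (v - s) y) (-kronF τ v y) 0 := by
  have := (kronF_hasDerivAt τ hτ v y hv hy)
  rw [← sub_zero v] at this
  have := this.comp_const_sub v 0
  simpa using this

lemma ev_plus (τ : ℂ) (hτ : 0 < τ.im) (v : ℂ) (hv : sg τ v ≠ 0) :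
    ∀ᶠ s in nhds (0 : ℂ), sg τ (v + s) ≠ 0 := by
  have hc : ContinuousAt (fun s => sg τ (v + s)) 0 :=
    ((sg_differentiable τ hτ).continuous.comp (continuous_const.add continuous_id)).continuousAt
  exact hc.eventually_ne (by simpa using hv)

lemma ev_minus (τ : ℂ) (hτ : 0 < τ.im) (v : ℂ) (hv : sg τ v ≠ 0) :
    ∀ᶠ s in nhds (0 : ℂ), sg τ (v - s) ≠ 0 := by
  have hc : ContinuousAt (fun s => sg τ (v - s)) 0 :=
    ((sg_differentiable τ hτ).continuous.comp (continuous_const.sub continuous_id)).continuousAt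
  exact hc.eventually_ne (by simpa using hv)

lemma fay_f (τ : ℂ) (hτ : 0 < τ.im) (u v x y : ℂ) (hu : sg τ u ≠ 0) (hv : sg τ v ≠ 0)
    (hx : sg τ x ≠ 0) (hy : sg τ y ≠ 0) (huv : sg τ (u + v) ≠ 0) (hyx : sg τ (y - x) ≠ 0) :
    kronPhi τ u x * kronF τ v y - kronF τ u x * kronPhi τ v y =
      kronPhi τ (u + v) x * kronF τ v (y - x) - kronPhi τ (u + v) y * kronF τ u (x - y) := by
  have hxy : sg τ (x - y) ≠ 0 := by
    rw [← neg_sub, sg_neg τ hτ]; exact neg_ne_zero.2 hyx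
  have l := (shift_minus τ hτ u x hu hx).mul (shift_plus τ hτ v y hv hy)
  have r := ((shift_plus τ hτ v (y - x) hv hyx).const_mul (kronPhi τ (u + v) x)).add
    ((shift_minus τ hτ u (x - y) hu hxy).const_mul (kronPhi τ (u + v) y))
  have e : ((fun s => kronPhi τ (u - s) x) * fun s => kronPhi τ (v + s) y) =ᶠ[nhds 0]
      ((fun s => kronPhi τ (u + v) x * kronPhi τ (v + s) (y - x)) +
        fun s => kronPhi τ (u + v) y * kronPhi τ (u - s) (x - y)) := by
    filter_upwards [ev_minus τ hτ u hu, ev_plus τ hτ v hv] with s h1 h2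
    have hs : u - s + (v + s) = u + v := by ring
    have := fay τ hτ (u - s) (v + s) x y h1 h2 hx hy (by rwa [hs]) hyx
    rw [hs] at this
    exact this
  have := l.unique (r.congr_of_eventuallyEq e)
  simp only [sub_zero, add_zero] at this
  linear_combination this

lemma E1_eq (τ : ℂ) (hτ : 0 < τ.im) (z : ℂ) :
    E1 τ z = (deriv (sg τ) z - Real.pi * I * sg τ z) / sg τ z := by
  rw [E1, (theta_hasDerivAt τ hτ z).deriv, theta_eq_sg, mul_div_mul_left _ _ (Complex.exp_ne_zero _)]

lemma E1_hasDerivAt (τ : ℂ) (hτ : 0 < τ.im) (z : ℂ) (hz : sg τ z ≠ 0) :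
    HasDerivAt (E1 τ) (-E2 τ z) z := by
  rw [E2, neg_neg]
  apply DifferentiableAt.hasDerivAt
  have e : E1 τ = fun z => (deriv (sg τ) z - Real.pi * I * sg τ z) / sg τ z := funext (E1_eq τ hτ)
  rw [e]
  have d := sg_differentiable τ hτ
  have d2 : DifferentiableAt ℂ (deriv (sg τ)) z := (d.analyticAt z).deriv.differentiableAt
  exact (d2.sub ((d z).const_mul _)).fun_div (d z) hz

lemma fay_diag (τ : ℂ) (hτ : 0 < τ.im) (w x : ℂ) : ∃ D : ℂ, ∀ u v, u + v = w → sg τ u ≠ 0 →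
    sg τ v ≠ 0 → sg τ x ≠ 0 → sg τ w ≠ 0 →
    kronPhi τ u x * kronPhi τ v x = kronPhi τ w x * (E1 τ u + E1 τ v) + D := by
  refine ⟨(sg τ (w + x) * deriv (sg τ) x / sg τ x - deriv (sg τ) (w + x)) * deriv (sg τ) 0 /
    (sg τ w * sg τ x) + 2 * (Real.pi * I) * kronPhi τ w x, ?_⟩
  intro u v huv hu hv hx hw
  subst huv
  have W := sg_W' τ hτ u v x
  simp only [kronPhi_eq τ hτ, E1_eq τ hτ]
  field_simp
  linear_combination deriv (sg τ) 0 * W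

lemma fay_f_diag (τ : ℂ) (hτ : 0 < τ.im) (u v x : ℂ) (hu : sg τ u ≠ 0) (hv : sg τ v ≠ 0)
    (hx : sg τ x ≠ 0) (huv : sg τ (u + v) ≠ 0) :
    kronPhi τ u x * kronF τ v x - kronF τ u x * kronPhi τ v x =
      kronPhi τ (u + v) x * (wp τ u - wp τ v) := by
  obtain ⟨D, hD⟩ := fay_diag τ hτ (u + v) x
  have l := (shift_minus τ hτ u x hu hx).mul (shift_plus τ hτ v x hv hx)
  have du : HasDerivAt (fun s => E1 τ (u - s)) (E2 τ u) 0 := by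
    have := E1_hasDerivAt τ hτ u hu
    rw [← sub_zero u] at this
    have := this.comp_const_sub u 0
    simpa using this
  have dv : HasDerivAt (fun s => E1 τ (v + s)) (-E2 τ v) 0 := by
    have := E1_hasDerivAt τ hτ v hv
    rw [← add_zero v] at this
    have := this.comp_const_add v 0
    simpa using this
  have r := ((du.add dv).const_mul (kronPhi τ (u + v) x)).add_const D
  have e : ((fun s => kronPhi τ (u - s) x) * fun s => kronPhi τ (v + s) x) =ᶠ[nhds 0]
      (fun s => kronPhi τ (u + v) x * ((fun s => E1 τ (u - s)) + fun s => E1 τ (v + s)) s + D) := by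
    filter_upwards [ev_minus τ hτ u hu, ev_plus τ hτ v hv] with s h1 h2
    exact hD (u - s) (v + s) (by ring) h1 h2 hx huv
  have := l.unique (r.congr_of_eventuallyEq e)
  simp only [sub_zero, add_zero] at this
  rw [wp, wp]
  linear_combination this

lemma eN_mul (N : ℕ) (a b : ℂ) : eN N a * eN N b = eN N (a + b) := by
  rw [eN, eN, eN, ← Complex.exp_add]; congr 1; ring

lemma om_add (N : ℕ) (τ : ℂ) (α β : ℤ × ℤ) : om N τ (α + β) = om N τ α + om N τ β := by
  simp only [om, Prod.fst_add, Prod.snd_add]; push_cast; ring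

lemma fayG (N : ℕ) (τ : ℂ) (hτ : 0 < τ.im) (α β : ℤ × ℤ) (x y : ℂ) (hu : sg τ (om N τ α) ≠ 0)
    (hv : sg τ (om N τ β) ≠ 0) (hx : sg τ x ≠ 0) (hy : sg τ y ≠ 0)
    (huv : sg τ (om N τ (α + β)) ≠ 0) (hyx : sg τ (y - x) ≠ 0) :
    phiG N τ α x * fG N τ β y - fG N τ α x * phiG N τ β y =
      phiG N τ (α + β) x * fG N τ β (y - x) - phiG N τ (α + β) y * fG N τ α (x - y) := by
  rw [om_add] at huv
  have := fay_f τ hτ _ _ x y hu hv hx hy huv hyx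
  have e1 : eN N (((α + β).2 : ℤ) * x) * eN N ((β.2 : ℂ) * (y - x)) =
      eN N (α.2 * x) * eN N (β.2 * y) := by
    rw [eN_mul, eN_mul]; congr 1; simp only [Prod.snd_add]; push_cast; ring
  have e2 : eN N (((α + β).2 : ℤ) * y) * eN N ((α.2 : ℂ) * (x - y)) =
      eN N (α.2 * x) * eN N (β.2 * y) := by
    rw [eN_mul, eN_mul]; congr 1; simp only [Prod.snd_add]; push_cast; ring
  simp only [phiG, fG, om_add]
  linear_combination eN N (α.2 * x) * eN N (β.2 * y) * this
    - kronPhi τ (om N τ α + om N τ β) x * kronF τ (om N τ β) (y - x) * e1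
    + kronPhi τ (om N τ α + om N τ β) y * kronF τ (om N τ α) (x - y) * e2

lemma fayG_diag (N : ℕ) (τ : ℂ) (hτ : 0 < τ.im) (α β : ℤ × ℤ) (x : ℂ) (hu : sg τ (om N τ α) ≠ 0)
    (hv : sg τ (om N τ β) ≠ 0) (hx : sg τ x ≠ 0) (huv : sg τ (om N τ (α + β)) ≠ 0) :
    phiG N τ α x * fG N τ β x - fG N τ α x * phiG N τ β x =
      phiG N τ (α + β) x * (wp τ (om N τ α) - wp τ (om N τ β)) := by
  rw [om_add] at huv
  have := fay_f_diag τ hτ _ _ x hu hv hx huv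
  have e1 : eN N (((α + β).2 : ℤ) * x) = eN N (α.2 * x) * eN N (β.2 * x) := by
    rw [eN_mul]; congr 1; simp only [Prod.snd_add]; push_cast; ring
  simp only [phiG, fG, om_add, e1]
  linear_combination eN N (α.2 * x) * eN N (β.2 * x) * this

lemma phiG_per1 (N : ℕ) (hN : N ≠ 0) (τ : ℂ) (hτ : 0 < τ.im) (a b : ℤ) (x : ℂ) :
    phiG N τ (a + N, b) x = phiG N τ (a, b) x := by
  have hN' : (N : ℂ) ≠ 0 := by exact_mod_cast hN
  have : om N τ (a + N, b) = om N τ (a, b) + 1 := by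
    simp only [om]; push_cast; field_simp; ring
  simp only [phiG, this, kronPhi_eq τ hτ]
  rw [show om N τ (a, b) + 1 + x = om N τ (a, b) + x + 1 by ring, sg_add_one, sg_add_one]
  rw [neg_mul, neg_mul, neg_div_neg_eq]

lemma phiG_per2 (N : ℕ) (hN : N ≠ 0) (τ : ℂ) (hτ : 0 < τ.im) (a b : ℤ) (x : ℂ) :
    phiG N τ (a, b + N) x = phiG N τ (a, b) x := by
  have hN' : (N : ℂ) ≠ 0 := by exact_mod_cast hN
  have : om N τ (a, b + N) = om N τ (a, b) + τ := by
    simp only [om]; push_cast; field_simp; ring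
  simp only [phiG, this, kronPhi_eq τ hτ]
  set u := om N τ (a, b)
  rw [show u + τ + x = u + x + τ by ring, sg_add_tau, sg_add_tau]
  have e1 : eN N (((b + N : ℤ) : ℂ) * x) = eN N (b * x) * cexp (2 * Real.pi * I * x) := by
    rw [eN, eN, ← Complex.exp_add]; congr 1; push_cast; field_simp
  have e2 : cexp (-(Real.pi * I * τ) - 2 * Real.pi * I * u) =
      cexp (-(Real.pi * I * τ) - 2 * Real.pi * I * (u + x)) * cexp (2 * Real.pi * I * x) := by
    rw [← Complex.exp_add]; congr 1; ring
  rw [e1, e2]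
  have h1 := Complex.exp_ne_zero (2 * Real.pi * I * x)
  have h2 := Complex.exp_ne_zero (-(Real.pi * I * τ) - 2 * Real.pi * I * (u + x))
  generalize cexp (2 * Real.pi * I * x) = p at *
  generalize cexp (-(Real.pi * I * τ) - 2 * Real.pi * I * (u + x)) = r at *
  rw [mul_assoc]
  congr 1
  rw [← mul_div_assoc, show p * (-r * sg τ (u + x) * deriv (sg τ) 0) =
    (-(r * p)) * (sg τ (u + x) * deriv (sg τ) 0) by ring,
    show -(r * p) * sg τ u * sg τ x = (-(r * p)) * (sg τ u * sg τ x) by ring,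
    mul_div_mul_left _ _ (neg_ne_zero.2 (mul_ne_zero h2 h1))]

lemma phiG_continuousAt (N : ℕ) (τ : ℂ) (hτ : 0 < τ.im) (γ : ℤ × ℤ) (x : ℂ)
    (hu : sg τ (om N τ γ) ≠ 0) (hx : sg τ x ≠ 0) : ContinuousAt (phiG N τ γ) x := by
  have e : phiG N τ γ = fun x => eN N ((γ.2 : ℂ) * x) *
    (sg τ (om N τ γ + x) * deriv (sg τ) 0 / (sg τ (om N τ γ) * sg τ x)) :=
    funext fun x => by rw [phiG, kronPhi_eq τ hτ]
  rw [e]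
  have c := (sg_differentiable τ hτ).continuous
  have c1 : Continuous fun x => eN N ((γ.2 : ℂ) * x) := by unfold eN; fun_prop
  refine c1.continuousAt.mul (ContinuousAt.div ?_ ?_ (mul_ne_zero hu hx))
  · exact ((c.comp (continuous_const.add continuous_id)).mul continuous_const).continuousAt
  · exact (continuous_const.mul c).continuousAt

lemma phiG_limit (N : ℕ) (τ : ℂ) (hτ : 0 < τ.im) (γ : ℤ × ℤ) (hu : sg τ (om N τ γ) ≠ 0) :
    Filter.Tendsto (fun x => x * phiG N τ γ x) (nhdsWithin 0 {0}ᶜ) (nhds 1) := by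
  have c := (sg_differentiable τ hτ).continuous
  have c1 : Continuous fun x => eN N ((γ.2 : ℂ) * x) := by unfold eN; fun_prop
  have hs := (sg_hasDerivAt τ hτ 0).tendsto_slope
  have hd := sg_deriv_zero_ne τ hτ
  have c2 : Continuous fun x => eN N ((γ.2 : ℂ) * x) *
    (sg τ (om N τ γ + x) * deriv (sg τ) 0 / sg τ (om N τ γ)) :=
    c1.mul (((c.comp (continuous_const.add continuous_id)).mul continuous_const).div_const _)
  have h := (((c2.tendsto 0).mono_left (nhdsWithin_le_nhds (s := {0}ᶜ))).mul (hs.inv₀ hd))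
  have hlim : eN N ((γ.2 : ℂ) * 0) * (sg τ (om N τ γ + 0) * deriv (sg τ) 0 / sg τ (om N τ γ)) *
      (deriv (sg τ) 0)⁻¹ = 1 := by
    simp only [mul_zero, add_zero, eN, zero_div, Complex.exp_zero, one_mul]
    field_simp
  rw [hlim] at h
  refine h.congr' ?_
  filter_upwards [self_mem_nhdsWithin] with x hx
  rw [phiG, kronPhi_eq τ hτ, slope_def_field, sg_zero τ hτ, sub_zero, sub_zero, inv_div]
  field_simp


/-- Unnormalised basis matrices. -/
def Bm (N a b : ℕ) : Matrix (Fin N) (Fin N) ℂ := Qm N ^ a * Lm N ^ b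

lemma eN_one_pow (N k : ℕ) : eN N 1 ^ k = eN N k := by
  rw [eN, eN, ← Complex.exp_nat_mul]; congr 1; ring

lemma eN_prim (N : ℕ) (hN : N ≠ 0) : IsPrimitiveRoot (eN N 1) N := by
  rw [eN, mul_one]; exact Complex.isPrimitiveRoot_exp N hN

lemma eN_pow_congr (N : ℕ) (hN : N ≠ 0) {a b : ℕ} (h : a ≡ b [MOD N]) :
    eN N 1 ^ a = eN N 1 ^ b := by
  have h1 := (eN_prim N hN).pow_eq_one
  have h' : a % N = b % N := h
  rw [pow_eq_pow_mod a h1, h', ← pow_eq_pow_mod b h1]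

lemma Lm_mul_Qm (N : ℕ) (hN : N ≠ 0) : Lm N * Qm N = eN N 1 • (Qm N * Lm N) := by
  ext i j
  rw [Matrix.smul_apply, Qm, Matrix.mul_diagonal, Matrix.diagonal_mul, Lm, Matrix.of_apply]
  have hp : ∀ k : ℕ, eN N ((k : ℂ) + 1) = eN N 1 ^ (k + 1) := by
    intro k; rw [eN_one_pow]; push_cast; rfl
  by_cases h : ((i : ℕ) + 1) % N = (j : ℕ)
  · simp only [h, if_true, one_mul, mul_one, smul_eq_mul, hp]
    rw [← pow_succ']
    apply eN_pow_congr N hN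
    have := Nat.mod_modEq ((i : ℕ) + 1) N
    rw [h] at this
    exact this.add_right 1
  · simp [h]

lemma Lm_inv (N : ℕ) : Lm N * (Lm N)ᵀ = 1 := by
  ext i j
  have hN : 0 < N := i.pos
  rw [Matrix.mul_apply]
  simp only [Lm, Matrix.transpose_apply, Matrix.of_apply]
  rw [Finset.sum_eq_single (⟨((i : ℕ) + 1) % N, Nat.mod_lt _ hN⟩ : Fin N)]
  · rw [if_pos rfl, one_mul, Matrix.one_apply]
    congr 1
    simp only [eq_iff_iff]
    constructor
    · intro h
      have h' : (j : ℕ) + 1 ≡ i + 1 [MOD N] := h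
      have := (Nat.ModEq.add_right_cancel' 1 h')
      exact Fin.ext (Nat.ModEq.eq_of_lt_of_lt this j.2 i.2).symm
    · rintro rfl; rfl
  · intro b _ hb
    rw [if_neg, zero_mul]
    intro h; exact hb (Fin.ext h.symm)
  · simp

/-- Inverse of `Qm`. -/
def Qi (N : ℕ) : Matrix (Fin N) (Fin N) ℂ := Matrix.diagonal fun i => (eN N ((i : ℕ) + 1))⁻¹

lemma Qi_mul (N : ℕ) : Qi N * Qm N = 1 := by
  rw [Qi, Qm, Matrix.diagonal_mul_diagonal, ← Matrix.diagonal_one]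
  congr 1; ext i
  exact inv_mul_cancel₀ (Complex.exp_ne_zero _)

lemma Lm_mul_Qpow (N : ℕ) (hN : N ≠ 0) (a : ℕ) :
    Lm N * Qm N ^ a = eN N 1 ^ a • (Qm N ^ a * Lm N) := by
  induction a with
  | zero => simp
  | succ k ih =>
    rw [pow_succ, ← mul_assoc, ih, smul_mul_assoc, mul_assoc, Lm_mul_Qm N hN, mul_smul_comm,
      smul_smul, ← pow_succ, mul_assoc]

lemma Lpow_mul_Qpow (N : ℕ) (hN : N ≠ 0) (b a : ℕ) :
    Lm N ^ b * Qm N ^ a = eN N 1 ^ (a * b) • (Qm N ^ a * Lm N ^ b) := by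
  induction b with
  | zero => simp
  | succ k ih =>
    rw [pow_succ, mul_assoc, Lm_mul_Qpow N hN, mul_smul_comm, ← mul_assoc, ih, smul_mul_assoc,
      smul_smul, ← pow_add, mul_assoc]
    congr 2; ring

lemma Bm_mul (N : ℕ) (hN : N ≠ 0) (a b c d : ℕ) :
    Bm N a b * Bm N c d = eN N 1 ^ (c * b) • Bm N (a + c) (b + d) := by
  rw [Bm, Bm, Bm, mul_assoc, ← mul_assoc (Lm N ^ b), Lpow_mul_Qpow N hN, smul_mul_assoc,
    mul_smul_comm, pow_add, pow_add]
  simp only [mul_assoc]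

/-- Conjugation by `Q`. -/
def Xop (N : ℕ) : Module.End ℂ (Matrix (Fin N) (Fin N) ℂ) :=
  LinearMap.mulLeft ℂ (Qi N) ∘ₗ LinearMap.mulRight ℂ (Qm N)

/-- Conjugation by `Λ`. -/
def Yop (N : ℕ) : Module.End ℂ (Matrix (Fin N) (Fin N) ℂ) :=
  LinearMap.mulLeft ℂ (Lm N) ∘ₗ LinearMap.mulRight ℂ ((Lm N)ᵀ)

lemma Xop_Bm (N : ℕ) (hN : N ≠ 0) (a b : ℕ) : Xop N (Bm N a b) = eN N 1 ^ b • Bm N a b := by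
  simp only [Xop, LinearMap.comp_apply, LinearMap.mulLeft_apply, LinearMap.mulRight_apply, Bm]
  have := Lpow_mul_Qpow N hN b 1
  rw [pow_one, one_mul] at this
  rw [mul_assoc (Qm N ^ a), this, mul_smul_comm, mul_smul_comm, ← mul_assoc (Qm N ^ a), ← pow_succ,
    pow_succ', mul_assoc, ← mul_assoc, Qi_mul, one_mul]

lemma Yop_Bm (N : ℕ) (hN : N ≠ 0) (a b : ℕ) : Yop N (Bm N a b) = eN N 1 ^ a • Bm N a b := by
  simp only [Yop, LinearMap.comp_apply, LinearMap.mulLeft_apply, LinearMap.mulRight_apply, Bm]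
  rw [← mul_assoc, ← mul_assoc, Lm_mul_Qpow N hN, smul_mul_assoc, smul_mul_assoc,
    mul_assoc (Qm N ^ a), ← pow_succ', pow_succ, mul_assoc, mul_assoc, Lm_inv, mul_one]

lemma end_pow_eig {V : Type*} [AddCommGroup V] [Module ℂ V] (X : Module.End ℂ V) (v : V) (c : ℂ)
    (h : X v = c • v) (i : ℕ) : (X ^ i) v = c ^ i • v := by
  induction i with
  | zero => simp
  | succ k ih => rw [pow_succ, Module.End.mul_apply, h, map_smul, ih, smul_smul, pow_succ']

lemma orth (N : ℕ) (hN : N ≠ 0) (m : ℤ) :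
    ∑ i ∈ range N, (eN N 1 ^ m) ^ i = if (N : ℤ) ∣ m then (N : ℂ) else 0 := by
  have hp := eN_prim N hN
  split_ifs with h
  · rw [(hp.zpow_eq_one_iff_dvd m).2 h]; simp
  · have h1 : eN N 1 ^ m ≠ 1 := fun e => h ((hp.zpow_eq_one_iff_dvd m).1 e)
    rw [geom_sum_eq h1, ← _root_.zpow_natCast, ← _root_.zpow_mul, mul_comm, _root_.zpow_mul, _root_.zpow_natCast, hp.pow_eq_one]
    simp

lemma mem_Gamma (N : ℕ) (γ : ℤ × ℤ) : γ ∈ GammaN' N ↔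
    ∃ a b : ℕ, a < N ∧ b < N ∧ ¬ (a = 0 ∧ b = 0) ∧ γ = ((a : ℤ), (b : ℤ)) := by
  simp only [GammaN', Finset.mem_sdiff, Finset.mem_image, Finset.mem_product, Finset.mem_range,
    Finset.mem_singleton, Prod.exists]
  constructor
  · rintro ⟨⟨a, b, ⟨ha, hb⟩, rfl⟩, h⟩
    refine ⟨a, b, ha, hb, ?_, rfl⟩
    rintro ⟨rfl, rfl⟩; exact h rfl
  · rintro ⟨a, b, ha, hb, h, rfl⟩
    refine ⟨⟨a, b, ⟨ha, hb⟩, rfl⟩, ?_⟩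
    intro h'
    apply h
    simpa using h'

lemma exists_Phi (N : ℕ) (hN : N ≠ 0) (φ : ℤ × ℤ → ℂ) :
    ∃ Φ : Matrix (Fin N) (Fin N) ℂ →ₗ[ℂ] Matrix (Fin N) (Fin N) ℂ, ∀ a b : ℕ,
      ¬ (a % N = 0 ∧ b % N = 0) →
      Φ (Bm N a b) = φ (((a % N : ℕ) : ℤ), ((b % N : ℕ) : ℤ)) • Bm N a b := by
  have hN' : (N : ℂ) ≠ 0 := by exact_mod_cast hN
  have hz : eN N 1 ≠ 0 := Complex.exp_ne_zero _
  refine ⟨∑ γ ∈ GammaN' N, (φ γ * ((N : ℂ) * N)⁻¹) • ∑ i ∈ range N, ∑ j ∈ range N,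
    ((eN N 1 ^ (-γ.2)) ^ i * (eN N 1 ^ (-γ.1)) ^ j) • (Xop N ^ i * Yop N ^ j), ?_⟩
  intro a b hab
  simp only [LinearMap.sum_apply, LinearMap.smul_apply, Module.End.mul_apply,
    end_pow_eig _ _ _ (Yop_Bm N hN a b), map_smul, end_pow_eig _ _ _ (Xop_Bm N hN a b), smul_smul]
  simp only [← Finset.sum_smul, smul_smul]
  congr 1
  have key : ∀ γ : ℤ × ℤ, ∑ i ∈ range N, ∑ j ∈ range N,
      (eN N 1 ^ (-γ.2)) ^ i * (eN N 1 ^ (-γ.1)) ^ j * (((eN N 1) ^ a) ^ j * ((eN N 1) ^ b) ^ i) =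
      (if (N : ℤ) ∣ b - γ.2 then (N : ℂ) else 0) * (if (N : ℤ) ∣ a - γ.1 then (N : ℂ) else 0) := by
    intro γ
    rw [← orth N hN, ← orth N hN, Finset.sum_mul_sum]
    refine Finset.sum_congr rfl fun i _ => Finset.sum_congr rfl fun j _ => ?_
    rw [sub_eq_neg_add, sub_eq_neg_add, zpow_add₀ hz, zpow_add₀ hz, zpow_natCast, zpow_natCast,
      mul_pow, mul_pow]
    ring
  simp only [key]
  have hmem : (((a % N : ℕ) : ℤ), ((b % N : ℕ) : ℤ)) ∈ GammaN' N :=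
    (mem_Gamma N _).2 ⟨a % N, b % N, Nat.mod_lt _ (Nat.pos_of_ne_zero hN),
      Nat.mod_lt _ (Nat.pos_of_ne_zero hN), hab, rfl⟩
  have hd : ∀ (k c : ℕ), c < N → ((N : ℤ) ∣ (k : ℤ) - c ↔ c = k % N) := by
    intro k c hc
    rw [← Nat.modEq_iff_dvd]
    constructor
    · intro h
      have := h; unfold Nat.ModEq at this
      rwa [Nat.mod_eq_of_lt hc] at this
    · rintro rfl; exact Nat.mod_modEq _ _
  rw [Finset.sum_eq_single_of_mem _ hmem]
  · rw [if_pos ((hd _ _ (Nat.mod_lt _ (Nat.pos_of_ne_zero hN))).2 rfl),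
      if_pos ((hd _ _ (Nat.mod_lt _ (Nat.pos_of_ne_zero hN))).2 rfl)]
    field_simp
  · intro γ hγ hne
    obtain ⟨c, d, hc, hd', _, rfl⟩ := (mem_Gamma N _).1 hγ
    by_cases h1 : (N : ℤ) ∣ (b : ℤ) - d
    · by_cases h2 : (N : ℤ) ∣ (a : ℤ) - c
      · exfalso; apply hne
        rw [(hd _ _ hd').1 h1, (hd _ _ hc).1 h2]
      · simp [h2]
    · simp [h1]

lemma phiG_mod (N : ℕ) (hN : N ≠ 0) (τ : ℂ) (hτ : 0 < τ.im) (a b : ℕ) (x : ℂ) :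
    phiG N τ (((a % N : ℕ) : ℤ), ((b % N : ℕ) : ℤ)) x = phiG N τ ((a : ℤ), (b : ℤ)) x := by
  have h1 : ∀ (k c : ℕ) (d : ℤ), phiG N τ (((c + N * k : ℕ) : ℤ), d) x = phiG N τ ((c : ℤ), d) x := by
    intro k c d
    induction k with
    | zero => simp
    | succ k ih =>
      rw [show ((c + N * (k + 1) : ℕ) : ℤ) = ((c + N * k : ℕ) : ℤ) + N by push_cast; ring,
        phiG_per1 N hN τ hτ, ih]
  have h2 : ∀ (k d : ℕ) (c : ℤ), phiG N τ (c, ((d + N * k : ℕ) : ℤ)) x = phiG N τ (c, (d : ℤ)) x := by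
    intro k c d
    induction k with
    | zero => simp
    | succ k ih =>
      rw [show ((c + N * (k + 1) : ℕ) : ℤ) = ((c + N * k : ℕ) : ℤ) + N by push_cast; ring,
        phiG_per2 N hN τ hτ, ih]
  conv_rhs => rw [← Nat.mod_add_div a N, ← Nat.mod_add_div b N, h1, h2]

lemma om_ne (N : ℕ) (hN : N ≠ 0) (τ : ℂ) (hτ : 0 < τ.im) (a b : ℕ)
    (h : ¬ (a % N = 0 ∧ b % N = 0)) : sg τ (om N τ ((a : ℤ), (b : ℤ))) ≠ 0 := by
  apply sg_ne_zero τ hτ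
  rintro ⟨m, k, hmk⟩
  have hN' : (N : ℝ) ≠ 0 := by exact_mod_cast hN
  have h2 : (((a / N : ℝ)) : ℂ) + ((b / N : ℝ) : ℂ) * τ = m + k * τ := by
    rw [← hmk, om]; push_cast; ring
  obtain ⟨e1, e2⟩ := lattice_coord hτ h2
  rw [div_eq_iff hN'] at e1 e2
  have e1' : (a : ℤ) = m * N := by exact_mod_cast e1
  have e2' : (b : ℤ) = k * N := by exact_mod_cast e2
  apply h
  constructor
  · exact Nat.mod_eq_zero_of_dvd (Int.natCast_dvd_natCast.1 ⟨m, by rw [e1']; ring⟩)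
  · exact Nat.mod_eq_zero_of_dvd (Int.natCast_dvd_natCast.1 ⟨k, by rw [e2']; ring⟩)

lemma Tm_eq (N a b : ℕ) : ∃ c : ℂ, Tm N ((a : ℤ), (b : ℤ)) = c • Bm N a b := by
  refine ⟨eN N ((((a : ℤ) * (b : ℤ) : ℤ) : ℂ) / 2), ?_⟩
  rw [Tm, Bm]
  simp only [_root_.zpow_natCast]

lemma T_comm (N : ℕ) (hN : N ≠ 0) (a b c d : ℕ) : ∃ k : ℂ,
    Tm N ((a : ℤ), (b : ℤ)) * Tm N ((c : ℤ), (d : ℤ)) - Tm N ((c : ℤ), (d : ℤ)) * Tm N ((a : ℤ), (b : ℤ))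
      = k • Bm N (a + c) (b + d) ∧ ((a + c) % N = 0 ∧ (b + d) % N = 0 → k = 0) := by
  obtain ⟨p, hp⟩ := Tm_eq N a b
  obtain ⟨r, hr⟩ := Tm_eq N c d
  refine ⟨p * r * (eN N 1 ^ (c * b) - eN N 1 ^ (a * d)), ?_, ?_⟩
  · rw [hp, hr, smul_mul_smul_comm, smul_mul_smul_comm, Bm_mul N hN, Bm_mul N hN, add_comm c a,
      add_comm d b, smul_smul, smul_smul, ← sub_smul]
    congr 1; ring
  · rintro ⟨h1, h2⟩
    have : eN N 1 ^ (c * b) = eN N 1 ^ (a * d) := by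
      apply eN_pow_congr N hN
      have h1' : a + c ≡ 0 [MOD N] := h1
      have h2' : b + d ≡ 0 [MOD N] := h2
      have e1 : (a + c) * b ≡ 0 * b [MOD N] := h1'.mul_right b
      have e2 : a * (b + d) ≡ a * 0 [MOD N] := h2'.mul_left a
      have e3 : a * b + c * b ≡ a * b + a * d [MOD N] := by
        rw [← add_mul, ← mul_add]; simp only [zero_mul, mul_zero] at e1 e2
        exact e1.trans e2.symm
      exact Nat.ModEq.add_left_cancel' _ e3
    rw [this, sub_self, mul_zero]


/-- Commutator of basis matrices. -/
def Kc (N : ℕ) (α β : ℤ × ℤ) : Matrix (Fin N) (Fin N) ℂ := Tm N α * Tm N β - Tm N β * Tm N α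

lemma Kc_swap (N : ℕ) (α β : ℤ × ℤ) : Kc N β α = - Kc N α β := by simp [Kc]

lemma comm_expand (N : ℕ) {ι κ : Type*} (I : Finset ι) (J : Finset κ) (u : ι → ℂ) (v : κ → ℂ)
    (p : ι → ℤ × ℤ) (r : κ → ℤ × ℤ) :
    (∑ i ∈ I, u i • Tm N (p i)) * (∑ j ∈ J, v j • Tm N (r j))
      - (∑ j ∈ J, v j • Tm N (r j)) * (∑ i ∈ I, u i • Tm N (p i)) =
    ∑ i ∈ I, ∑ j ∈ J, (u i * v j) • Kc N (p i) (r j) := by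
  rw [Finset.sum_mul_sum, Finset.sum_mul_sum, Finset.sum_comm (s := J), ← Finset.sum_sub_distrib]
  refine Finset.sum_congr rfl fun i _ => ?_
  rw [← Finset.sum_sub_distrib]
  refine Finset.sum_congr rfl fun j _ => ?_
  rw [smul_mul_smul_comm, smul_mul_smul_comm, Kc, smul_sub, mul_comm (v j)]

lemma swap_sum {ι V : Type*} [AddCommGroup V] [Module ℂ V] (P : Finset ι) (K : ι → ι → V)
    (hK : ∀ i j, K j i = - K i j) (c d : ι → ι → ℂ)
    (h : ∀ i ∈ P, ∀ j ∈ P, (c i j - c j i) • K i j = (d i j - d j i) • K i j) :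
    ∑ i ∈ P, ∑ j ∈ P, c i j • K i j = ∑ i ∈ P, ∑ j ∈ P, d i j • K i j := by
  have key : ∀ e : ι → ι → ℂ, (2 : ℂ) • ∑ i ∈ P, ∑ j ∈ P, e i j • K i j =
      ∑ i ∈ P, ∑ j ∈ P, (e i j - e j i) • K i j := by
    intro e
    rw [two_smul]
    conv_lhs => arg 2; rw [Finset.sum_comm]
    rw [← Finset.sum_add_distrib]
    refine Finset.sum_congr rfl fun i _ => ?_
    rw [← Finset.sum_add_distrib]
    refine Finset.sum_congr rfl fun j _ => ?_
    rw [hK i j, smul_neg, sub_smul, sub_eq_add_neg]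
  have h2 : (2 : ℂ) • ∑ i ∈ P, ∑ j ∈ P, c i j • K i j =
      (2 : ℂ) • ∑ i ∈ P, ∑ j ∈ P, d i j • K i j := by
    rw [key, key]
    exact Finset.sum_congr rfl fun i hi => Finset.sum_congr rfl fun j hj => h i hi j hj
  have h3 := congrArg (fun v => (2 : ℂ)⁻¹ • v) h2
  simpa [smul_smul] using h3

/-- The operator `T_γ ↦ φ_γ(x) T_γ`. -/
def Phi (N : ℕ) (hN : N ≠ 0) (τ x : ℂ) :
    Matrix (Fin N) (Fin N) ℂ →ₗ[ℂ] Matrix (Fin N) (Fin N) ℂ :=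
  (exists_Phi N hN (fun γ => phiG N τ γ x)).choose

lemma Phi_Bm (N : ℕ) (hN : N ≠ 0) (τ : ℂ) (hτ : 0 < τ.im) (x : ℂ) (a b : ℕ)
    (h : ¬ (a % N = 0 ∧ b % N = 0)) :
    Phi N hN τ x (Bm N a b) = phiG N τ ((a : ℤ), (b : ℤ)) x • Bm N a b := by
  rw [Phi, (exists_Phi N hN (fun γ => phiG N τ γ x)).choose_spec a b h, phiG_mod N hN τ hτ]

lemma small_mod {N a b : ℕ} (ha : a < N) (hb : b < N) (h : ¬ (a = 0 ∧ b = 0)) :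
    ¬ (a % N = 0 ∧ b % N = 0) := by
  rwa [Nat.mod_eq_of_lt ha, Nat.mod_eq_of_lt hb]

/-- The set of traceless basis matrices. -/
def Bset (N : ℕ) : Set (Matrix (Fin N) (Fin N) ℂ) :=
  {X | ∃ a b : ℕ, ¬ (a % N = 0 ∧ b % N = 0) ∧ X = Bm N a b}

lemma om_ne_mem (N : ℕ) (hN : N ≠ 0) (τ : ℂ) (hτ : 0 < τ.im) {γ : ℤ × ℤ} (h : γ ∈ GammaN' N) :
    sg τ (om N τ γ) ≠ 0 := by
  obtain ⟨a, b, ha, hb, hab, rfl⟩ := (mem_Gamma N γ).1 h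
  exact om_ne N hN τ hτ a b (small_mod ha hb hab)

lemma Tm_span (N : ℕ) {γ : ℤ × ℤ} (h : γ ∈ GammaN' N) :
    Tm N γ ∈ Submodule.span ℂ (Bset N) := by
  obtain ⟨a, b, ha, hb, hab, rfl⟩ := (mem_Gamma N γ).1 h
  obtain ⟨c, hc⟩ := Tm_eq N a b
  rw [hc]
  exact Submodule.smul_mem _ _ (Submodule.subset_span ⟨a, b, small_mod ha hb hab, rfl⟩)

lemma Phi_Tm (N : ℕ) (hN : N ≠ 0) (τ : ℂ) (hτ : 0 < τ.im) (x : ℂ) {γ : ℤ × ℤ}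
    (h : γ ∈ GammaN' N) : Phi N hN τ x (Tm N γ) = phiG N τ γ x • Tm N γ := by
  obtain ⟨a, b, ha, hb, hab, rfl⟩ := (mem_Gamma N γ).1 h
  obtain ⟨c, hc⟩ := Tm_eq N a b
  rw [hc, map_smul, Phi_Bm N hN τ hτ x a b (small_mod ha hb hab), smul_comm]

lemma Kc_cases (N : ℕ) (hN : N ≠ 0) (τ : ℂ) (hτ : 0 < τ.im) {α β : ℤ × ℤ}
    (hα : α ∈ GammaN' N) (hβ : β ∈ GammaN' N) :
    Kc N α β = 0 ∨ (sg τ (om N τ (α + β)) ≠ 0 ∧ Kc N α β ∈ Submodule.span ℂ (Bset N) ∧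
      ∀ x, Phi N hN τ x (Kc N α β) = phiG N τ (α + β) x • Kc N α β) := by
  obtain ⟨a, b, ha, hb, hab, rfl⟩ := (mem_Gamma N α).1 hα
  obtain ⟨c, d, hc, hd, hcd, rfl⟩ := (mem_Gamma N β).1 hβ
  obtain ⟨k, hk, hk0⟩ := T_comm N hN a b c d
  by_cases h : (a + c) % N = 0 ∧ (b + d) % N = 0
  · left; rw [Kc, hk, hk0 h, zero_smul]
  · right
    have e : (((a : ℤ), (b : ℤ)) + ((c : ℤ), (d : ℤ)) : ℤ × ℤ) =
        (((a + c : ℕ) : ℤ), ((b + d : ℕ) : ℤ)) := by ext <;> simp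
    rw [e, Kc, hk]
    refine ⟨om_ne N hN τ hτ _ _ h,
      Submodule.smul_mem _ _ (Submodule.subset_span ⟨_, _, h, rfl⟩), fun x => ?_⟩
    rw [map_smul, Phi_Bm N hN τ hτ x _ _ h, smul_comm]

lemma Kc_span (N : ℕ) (hN : N ≠ 0) (τ : ℂ) (hτ : 0 < τ.im) {α β : ℤ × ℤ}
    (hα : α ∈ GammaN' N) (hβ : β ∈ GammaN' N) : Kc N α β ∈ Submodule.span ℂ (Bset N) := by
  rcases Kc_cases N hN τ hτ hα hβ with h | h
  · rw [h]; exact Submodule.zero_mem _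
  · exact h.2.1

lemma Phi_Kc (N : ℕ) (hN : N ≠ 0) (τ : ℂ) (hτ : 0 < τ.im) {α β : ℤ × ℤ}
    (hα : α ∈ GammaN' N) (hβ : β ∈ GammaN' N) (x : ℂ) :
    Phi N hN τ x (Kc N α β) = phiG N τ (α + β) x • Kc N α β := by
  rcases Kc_cases N hN τ hτ hα hβ with h | h
  · rw [h, map_zero, smul_zero]
  · exact h.2.2 x

lemma Phi_lim (N : ℕ) (hN : N ≠ 0) (τ : ℂ) (hτ : 0 < τ.im) {E : Matrix (Fin N) (Fin N) ℂ}
    (hE : E ∈ Submodule.span ℂ (Bset N)) :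
    Filter.Tendsto (fun x => x • Phi N hN τ x E) (nhdsWithin 0 {0}ᶜ) (nhds E) := by
  induction hE using Submodule.span_induction with
  | mem X hX =>
    obtain ⟨a, b, h, rfl⟩ := hX
    simp only [Phi_Bm N hN τ hτ _ a b h, smul_smul]
    have := (phiG_limit N τ hτ _ (om_ne N hN τ hτ a b h)).smul_const (Bm N a b)
    rwa [one_smul] at this
  | zero => simp
  | add X Y _ _ h1 h2 => simpa only [map_add, smul_add] using h1.add h2
  | smul c X _ h =>
    have := h.const_smul c
    simp only [map_smul]
    refine this.congr fun x => smul_comm _ _ _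

lemma Phi_cont (N : ℕ) (hN : N ≠ 0) (τ : ℂ) (hτ : 0 < τ.im) {E : Matrix (Fin N) (Fin N) ℂ}
    (hE : E ∈ Submodule.span ℂ (Bset N)) (x : ℂ) (hx : sg τ x ≠ 0) :
    ContinuousAt (fun x => Phi N hN τ x E) x := by
  induction hE using Submodule.span_induction with
  | mem X hX =>
    obtain ⟨a, b, h, rfl⟩ := hX
    simp only [Phi_Bm N hN τ hτ _ a b h]
    exact (phiG_continuousAt N τ hτ _ x (om_ne N hN τ hτ a b h) hx).smul continuousAt_const
  | zero => simpa using continuousAt_const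
  | add X Y _ _ h1 h2 =>
    simp only [map_add]
    exact h1.add h2
  | smul c X _ h =>
    simp only [map_smul]
    exact h.const_smul c

/-- If a sum of such operator functions vanishes off the lattice then all residues vanish. -/
lemma residues_zero (N : ℕ) (hN : N ≠ 0) (τ : ℂ) (hτ : 0 < τ.im) (n : ℕ) (z : Fin n → ℂ)
    (hz : ∀ a c : Fin n, a ≠ c → z a - z c ∉ latticeGamma τ)
    (E : Fin n → Matrix (Fin N) (Fin N) ℂ) (hE : ∀ a, E a ∈ Submodule.span ℂ (Bset N))
    (h : ∀ w : ℂ, (∀ c : Fin n, w - z c ∉ latticeGamma τ) →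
      ∑ c : Fin n, Phi N hN τ (w - z c) (E c) = 0) (a : Fin n) : E a = 0 := by
  have c := (sg_differentiable τ hτ).continuous
  have hgood : ∀ᶠ x in nhdsWithin (0 : ℂ) {0}ᶜ, ∀ c : Fin n, (x + z a) - z c ∉ latticeGamma τ := by
    rw [Filter.eventually_all]
    intro b
    have hs : ∀ᶠ x in nhdsWithin (0 : ℂ) {0}ᶜ, sg τ ((x + z a) - z b) ≠ 0 := by
      by_cases hb : b = a
      · subst hb
        have := (sg_hasDerivAt τ hτ 0).eventually_ne (c := 0) (sg_deriv_zero_ne τ hτ)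
        simpa using this
      · have hc : ContinuousAt (fun x => sg τ ((x + z a) - z b)) 0 := by
          apply Continuous.continuousAt; fun_prop
        refine (hc.eventually_ne ?_).filter_mono nhdsWithin_le_nhds
        simpa using sg_ne_zero τ hτ (hz a b (Ne.symm hb))
    filter_upwards [hs] with x hx h'
    exact hx (sg_lattice_zero τ hτ h')
  have t1 : Filter.Tendsto (fun x => ∑ c : Fin n, x • Phi N hN τ ((x + z a) - z c) (E c))
      (nhdsWithin 0 {0}ᶜ) (nhds (∑ c : Fin n, if c = a then E a else 0)) := by
    refine tendsto_finsetSum _ fun b _ => ?_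
    split_ifs with hb
    · subst hb
      simpa using Phi_lim N hN τ hτ (hE b)
    · have hc : ContinuousAt (fun x => x • Phi N hN τ ((x + z a) - z b) (E b)) 0 := by
        refine continuousAt_id.smul ?_
        have := Phi_cont N hN τ hτ (hE b) (z a - z b) (sg_ne_zero τ hτ (hz a b (Ne.symm hb)))
        refine ContinuousAt.comp (f := fun x => x + z a - z b)
          (g := fun x => Phi N hN τ x (E b)) ?_ (by fun_prop)
        simpa using this
      have := hc.tendsto.mono_left (nhdsWithin_le_nhds (s := {0}ᶜ))
      simpa using this
  have t2 : Filter.Tendsto (fun x => ∑ c : Fin n, x • Phi N hN τ ((x + z a) - z c) (E c))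
      (nhdsWithin 0 {0}ᶜ) (nhds 0) := by
    refine tendsto_const_nhds.congr' ?_
    filter_upwards [hgood] with x hx
    rw [← Finset.smul_sum, h _ hx, smul_zero]
  have := tendsto_nhds_unique t1 t2
  simpa using this

/-- Coefficient in the equations of motion. -/
def hco (N : ℕ) (τ : ℂ) {n : ℕ} (z : Fin n → ℂ) (a c : Fin n) (β : ℤ × ℤ) : ℂ :=
  if c = a then -wp τ (om N τ β) else fG N τ β (z a - z c)

/-- Right side of the equations of motion. -/
def Rm (N : ℕ) (τ : ℂ) {n : ℕ} (z : Fin n → ℂ) (S : Fin n → (ℤ × ℤ) → ℝ → ℂ) (t : ℝ)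
    (a : Fin n) : Matrix (Fin N) (Fin N) ℂ :=
  (Smat N S a t * wpHatS N τ S a t - wpHatS N τ S a t * Smat N S a t)
            - ∑ c ∈ Finset.univ.filter (fun c => c ≠ a),
                (Smat N S a t * fHatS N τ S (z a - z c) c t
                  - fHatS N τ S (z a - z c) c t * Smat N S a t)

lemma Rm_eq (N : ℕ) (τ : ℂ) {n : ℕ} (z : Fin n → ℂ) (S : Fin n → (ℤ × ℤ) → ℝ → ℂ) (t : ℝ)
    (a : Fin n) : Rm N τ z S t a = -∑ α ∈ GammaN' N, ∑ j ∈ univ ×ˢ GammaN' N,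
      (S a α t * S j.1 j.2 t * hco N τ z a j.1 j.2) • Kc N α j.2 := by
  have e1 : ∀ c : Fin n, ∑ α ∈ GammaN' N, ∑ β ∈ GammaN' N,
      (S a α t * S c β t * hco N τ z a c β) • Kc N α β =
      if c = a then -(Smat N S a t * wpHatS N τ S a t - wpHatS N τ S a t * Smat N S a t)
      else (Smat N S a t * fHatS N τ S (z a - z c) c t
                  - fHatS N τ S (z a - z c) c t * Smat N S a t) := by
    intro c
    split_ifs with h
    · subst h
      rw [Smat, wpHatS, comm_expand, ← Finset.sum_neg_distrib]
      refine Finset.sum_congr rfl fun α _ => ?_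
      rw [← Finset.sum_neg_distrib]
      refine Finset.sum_congr rfl fun β _ => ?_
      rw [hco, if_pos rfl, ← neg_smul]; congr 1; ring
    · rw [Smat, fHatS, comm_expand]
      refine Finset.sum_congr rfl fun α _ => Finset.sum_congr rfl fun β _ => ?_
      rw [hco, if_neg h, mul_assoc]
  simp only [Finset.sum_product]
  rw [Finset.sum_comm]
  simp only [e1]
  rw [← Finset.add_sum_erase _ _ (Finset.mem_univ a), if_pos rfl, Rm, neg_add, neg_neg,
    sub_eq_add_neg]
  congr 2
  rw [Finset.filter_ne']
  refine Finset.sum_congr rfl fun c hc => ?_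
  rw [if_neg (Finset.ne_of_mem_erase hc)]

lemma Rm_span (N : ℕ) (hN : N ≠ 0) (τ : ℂ) (hτ : 0 < τ.im) {n : ℕ} (z : Fin n → ℂ)
    (S : Fin n → (ℤ × ℤ) → ℝ → ℂ) (t : ℝ) (a : Fin n) :
    Rm N τ z S t a ∈ Submodule.span ℂ (Bset N) := by
  rw [Rm_eq]
  refine Submodule.neg_mem _ (Submodule.sum_mem _ fun α hα => Submodule.sum_mem _ fun j hj =>
    Submodule.smul_mem _ _ (Kc_span N hN τ hτ hα (Finset.mem_product.1 hj).2))

lemma lax_rhs (N : ℕ) (hN : N ≠ 0) (τ : ℂ) (hτ : 0 < τ.im) {n : ℕ} (z : Fin n → ℂ)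
    (hz : ∀ a c : Fin n, a ≠ c → z a - z c ∉ latticeGamma τ)
    (S : Fin n → (ℤ × ℤ) → ℝ → ℂ) (t : ℝ) (w : ℂ) (hw : ∀ c : Fin n, w - z c ∉ latticeGamma τ) :
    (∑ c : Fin n, ∑ γ ∈ GammaN' N, (S c γ t * phiG N τ γ (w - z c)) • Tm N γ)
                * (-(∑ b : Fin n, ∑ γ ∈ GammaN' N, (S b γ t * fG N τ γ (w - z b)) • Tm N γ))
              - (-(∑ b : Fin n, ∑ γ ∈ GammaN' N, (S b γ t * fG N τ γ (w - z b)) • Tm N γ))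
                * (∑ c : Fin n, ∑ γ ∈ GammaN' N,
                    (S c γ t * phiG N τ γ (w - z c)) • Tm N γ) =
    ∑ a : Fin n, Phi N hN τ (w - z a) (Rm N τ z S t a) := by
  have hR : ∑ a : Fin n, Phi N hN τ (w - z a) (Rm N τ z S t a) =
      -∑ i ∈ univ ×ˢ GammaN' N, ∑ j ∈ univ ×ˢ GammaN' N,
        (S i.1 i.2 t * S j.1 j.2 t * (phiG N τ (i.2 + j.2) (w - z i.1) * hco N τ z i.1 j.1 j.2)) •
          Kc N i.2 j.2 := by
    rw [Finset.sum_product, ← Finset.sum_neg_distrib]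
    refine Finset.sum_congr rfl fun a _ => ?_
    rw [Rm_eq, map_neg, map_sum]
    congr 1
    refine Finset.sum_congr rfl fun α hα => ?_
    rw [map_sum]
    refine Finset.sum_congr rfl fun j hj => ?_
    rw [map_smul, Phi_Kc N hN τ hτ hα (Finset.mem_product.1 hj).2, smul_smul]
    congr 1; ring
  rw [hR]
  rw [mul_neg, neg_mul, ← neg_sub', neg_inj]
  have p1 : ∀ g : Fin n → ℤ × ℤ → ℂ, ∑ c : Fin n, ∑ γ ∈ GammaN' N, g c γ • Tm N γ =
      ∑ i ∈ univ ×ˢ GammaN' N, g i.1 i.2 • Tm N i.2 := by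
    intro g; rw [Finset.sum_product]
  rw [p1 (fun c γ => S c γ t * phiG N τ γ (w - z c)), p1 (fun c γ => S c γ t * fG N τ γ (w - z c)),
    comm_expand]
  refine swap_sum (univ ×ˢ GammaN' N) (fun i j => Kc N i.2 j.2) (fun i j => Kc_swap N _ _)
    (fun i j => S i.1 i.2 t * phiG N τ i.2 (w - z i.1) * (S j.1 j.2 t * fG N τ j.2 (w - z j.1)))
    (fun i j => S i.1 i.2 t * S j.1 j.2 t *
      (phiG N τ (i.2 + j.2) (w - z i.1) * hco N τ z i.1 j.1 j.2)) ?_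
  rintro ⟨a, α⟩ hi ⟨b, β⟩ hj
  have hα := (Finset.mem_product.1 hi).2
  have hβ := (Finset.mem_product.1 hj).2
  dsimp only at hα hβ ⊢
  rcases Kc_cases N hN τ hτ hα hβ with h | ⟨hs, -, -⟩
  · rw [h, smul_zero, smul_zero]
  congr 1
  have nα := om_ne_mem N hN τ hτ hα
  have nβ := om_ne_mem N hN τ hτ hβ
  have na := sg_ne_zero τ hτ (hw a)
  have nb := sg_ne_zero τ hτ (hw b)
  rw [add_comm β α]
  by_cases hab : b = a
  · subst hab
    have F := fayG_diag N τ hτ α β (w - z b) nα nβ na hs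
    simp only [hco, if_true]
    linear_combination S b α t * S b β t * F
  · have e1 : w - z b - (w - z a) = z a - z b := by ring
    have e2 : w - z a - (w - z b) = z b - z a := by ring
    have F := fayG N τ hτ α β (w - z a) (w - z b) nα nβ na nb hs
      (by rw [e1]; exact sg_ne_zero τ hτ (hz a b (Ne.symm hab)))
    rw [e1, e2] at F
    simp only [hco, if_neg hab, if_neg (Ne.symm hab)]
    linear_combination S a α t * S b β t * F

/-- **Proposition 2.1, part 2** (the `H₀`-flow of the elliptic sl(N) Gaudin model):
the equations of motion hold iff the Lax equation `∂_t L = [L, M₀]` holds. -/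
theorem elliptic_gaudin_H0_flow_lax
    (τ : ℂ) (hτ : 0 < τ.im) (N : ℕ) (hN : 2 ≤ N)
    (n : ℕ) (z : Fin n → ℂ)
    (hz : ∀ a c : Fin n, a ≠ c → z a - z c ∉ latticeGamma τ)
    (S : Fin n → (ℤ × ℤ) → ℝ → ℂ)
    (hS : ∀ c γ, Differentiable ℝ (S c γ)) :
    (∀ t : ℝ, ∀ a : Fin n,
        (∑ γ ∈ GammaN' N, deriv (S a γ) t • Tm N γ)
          = (Smat N S a t * wpHatS N τ S a t - wpHatS N τ S a t * Smat N S a t)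
            - ∑ c ∈ Finset.univ.filter (fun c => c ≠ a),
                (Smat N S a t * fHatS N τ S (z a - z c) c t
                  - fHatS N τ S (z a - z c) c t * Smat N S a t))
    ↔ (∀ t : ℝ, ∀ w : ℂ, (∀ c : Fin n, w - z c ∉ latticeGamma τ) →
        (∑ c : Fin n, ∑ γ ∈ GammaN' N,
            (deriv (S c γ) t * phiG N τ γ (w - z c)) • Tm N γ)
          = (∑ c : Fin n, ∑ γ ∈ GammaN' N, (S c γ t * phiG N τ γ (w - z c)) • Tm N γ)
                * (-(∑ b : Fin n, ∑ γ ∈ GammaN' N, (S b γ t * fG N τ γ (w - z b)) • Tm N γ))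
              - (-(∑ b : Fin n, ∑ γ ∈ GammaN' N, (S b γ t * fG N τ γ (w - z b)) • Tm N γ))
                * (∑ c : Fin n, ∑ γ ∈ GammaN' N,
                    (S c γ t * phiG N τ γ (w - z c)) • Tm N γ)) := by
  have hN0 : N ≠ 0 := by omega
  have hL : ∀ t w, (∑ c : Fin n, ∑ γ ∈ GammaN' N,
      (deriv (S c γ) t * phiG N τ γ (w - z c)) • Tm N γ) =
      ∑ c : Fin n, Phi N hN0 τ (w - z c) (∑ γ ∈ GammaN' N, deriv (S c γ) t • Tm N γ) := by
    intro t w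
    refine Finset.sum_congr rfl fun c _ => ?_
    rw [map_sum]
    refine Finset.sum_congr rfl fun γ hγ => ?_
    rw [map_smul, Phi_Tm N hN0 τ hτ _ hγ, smul_smul]
  constructor
  · intro h t w hw
    rw [lax_rhs N hN0 τ hτ z hz S t w hw, hL]
    refine Finset.sum_congr rfl fun a _ => ?_
    rw [h t a, Rm]
  · intro h t a
    have key := residues_zero N hN0 τ hτ n z hz
      (fun a => (∑ γ ∈ GammaN' N, deriv (S a γ) t • Tm N γ) - Rm N τ z S t a)
      (fun a => Submodule.sub_mem _ (Submodule.sum_mem _ fun γ hγ =>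
        Submodule.smul_mem _ _ (Tm_span N hγ)) (Rm_span N hN0 τ hτ z S t a)) ?_ a
    · exact sub_eq_zero.1 key
    · intro w hw
      have h1 := h t w hw
      rw [lax_rhs N hN0 τ hτ z hz S t w hw, hL] at h1
      simp only [map_sub, Finset.sum_sub_distrib, h1, sub_self]

end
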